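/- Let M be a finitely generated module over R = ℤ[x₁,…,xₙ]. Then the supremum of u(M/pM), as p runs through all prime integers, is finite: there exists an integer B such that for every prime integer p and every associated prime 𝔮 of M/pM, the length of Γ_{𝔮R̄_𝔮}((M/pM)_𝔮) as an R̄_𝔮-module is at most B. -/

import Mathlib

noncomputable section

/-- `R = ℤ[x₁,…,xₙ]`. -/
abbrev Rint (n : ℕ) : Type := MvPolynomial (Fin n) ℤ

/-- `R̄ = R/pR`. -/
abbrev RbarQ (n p : ℕ) : Type := Rint n ⧸ Ideal.span {(p : Rint n)}

/-- `pN`, the submodule of multiples of `p`. -/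
abbrev pSM (n : ℕ) (p : ℕ) (N : Type*) [AddCommGroup N] [Module (Rint n) N] :
    Submodule (Rint n) N :=
  Ideal.span {(p : Rint n)} • (⊤ : Submodule (Rint n) N)

/-- `M̄ = M/pM`, an `R̄`-module. -/
abbrev Mbar (n p : ℕ) (M : Type*) [AddCommGroup M] [Module (Rint n) M] : Type _ :=
  M ⧸ pSM n p M

/-- `Γ_𝔞(N) = {x ∈ N | 𝔞ᵏ x = 0 for some k ≥ 0}`, the `𝔞`-torsion submodule. -/
def Gamma {A : Type*} [CommRing A] (I : Ideal A) {N : Type*} [AddCommGroup N] [Module A N] :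
    Submodule A N where
  carrier := {x | ∃ k : ℕ, ∀ a ∈ I ^ k, a • x = 0}
  zero_mem' := ⟨0, fun a _ => smul_zero a⟩
  add_mem' := by
    rintro x y ⟨k, hk⟩ ⟨l, hl⟩
    refine ⟨k + l, fun a ha => ?_⟩
    rw [smul_add, hk a (Ideal.pow_le_pow_right (Nat.le_add_right k l) ha),
      hl a (Ideal.pow_le_pow_right (Nat.le_add_left l k) ha), add_zero]
  smul_mem' := by
    rintro c x ⟨k, hk⟩
    exact ⟨k, fun a ha => by rw [smul_comm, hk a ha, smul_zero]⟩
/-- Saturated `Q`-torsion submodules; they model the submodules of `Γ_Q(N_Q)`. -/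
def Adm {R : Type*} [CommRing R] (Q : Ideal R) {N : Type*} [AddCommGroup N] [Module R N]
    (K : Submodule R N) : Prop :=
  (∀ s : R, s ∉ Q → ∀ x : N, s • x ∈ K → x ∈ K) ∧
    ∀ x ∈ K, ∃ k : ℕ, ∀ a ∈ Q ^ k, ∃ s : R, s ∉ Q ∧ s • a • x = 0

/-- The length of `Γ_Q(N_Q)` is at most `B`. -/
def Bd {R : Type*} [CommRing R] (Q : Ideal R) (N : Type*) [AddCommGroup N] [Module R N]
    (B : ℕ) : Prop :=
  ∃ f : Submodule R N → ℕ, (∀ K, Adm Q K → f K ≤ B) ∧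
    ∀ K L, Adm Q K → Adm Q L → K < L → f K < f L

section bdlemmas
variable {R : Type*} [CommRing R] {Q : Ideal R}
  {N : Type*} [AddCommGroup N] [Module R N]

theorem Bd.mono {B C : ℕ} (h : Bd Q N B) (hBC : B ≤ C) : Bd Q N C := by
  obtain ⟨f, h1, h2⟩ := h
  exact ⟨f, fun K hK => (h1 K hK).trans hBC, h2⟩

theorem Bd.of_eq (h : ∀ K L : Submodule R N, Adm Q K → Adm Q L → K ≤ L → L ≤ K) : Bd Q N 0 :=
  ⟨fun _ => 0, fun _ _ => le_rfl, fun K L hK hL hlt => absurd (h K L hK hL hlt.le) hlt.not_ge⟩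

theorem Bd.of_subsingleton [Subsingleton N] : Bd Q N 0 :=
  Bd.of_eq fun K L _ _ _ x _ => by rw [Subsingleton.elim x 0]; exact K.zero_mem

theorem Bd.of_kill {s : R} (hs : s ∉ Q) (h : ∀ x : N, s • x = 0) : Bd Q N 0 :=
  Bd.of_eq fun K L hK _ _ x _ => hK.1 s hs x (by rw [h]; exact K.zero_mem)

theorem Bd.of_regular {a : R} (ha : a ∈ Q) (h : ∀ x : N, a • x = 0 → x = 0) : Bd Q N 0 :=
  Bd.of_eq fun K L hK hL _ x hx => by
    obtain ⟨k, hk⟩ := hL.2 x hx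
    obtain ⟨s, hs, h0⟩ := hk (a ^ k) (Ideal.pow_mem_pow ha k)
    refine hK.1 s hs x ?_
    have : ∀ j : ℕ, ∀ y : N, a ^ j • y = 0 → y = 0 := by
      intro j
      induction j with
      | zero => intro y hy; simpa using hy
      | succ j ih =>
        intro y hy
        rw [pow_succ, mul_smul] at hy
        exact h _ (ih _ hy)
    rw [smul_comm] at h0
    rw [this k _ h0]
    exact K.zero_mem

/-- Subadditivity on left exact sequences. -/
theorem Bd.exact (hQ : Q.IsPrime) {N₁ N₃ : Type*} [AddCommGroup N₁] [Module R N₁]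
    [AddCommGroup N₃] [Module R N₃] (i : N₁ →ₗ[R] N) (g : N →ₗ[R] N₃)
    (hi : Function.Injective i) (hig : ∀ x, g x = 0 → ∃ y, i y = x)
    {b₁ b₃ : ℕ} (h₁ : Bd Q N₁ b₁) (h₃ : Bd Q N₃ b₃) : Bd Q N (b₁ + b₃) := by
  classical
  obtain ⟨f₁, le₁, lt₁⟩ := h₁
  obtain ⟨f₃, le₃, lt₃⟩ := h₃
  let sat : Submodule R N → Submodule R N₃ := fun K =>
    { carrier := {z | ∃ s : R, s ∉ Q ∧ ∃ x ∈ K, g x = s • z}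
      zero_mem' := ⟨1, fun h => hQ.ne_top ((Ideal.eq_top_iff_one _).2 h), 0, K.zero_mem, by simp⟩
      add_mem' := by
        rintro z w ⟨s, hs, x, hx, e⟩ ⟨t, ht, y, hy, e'⟩
        refine ⟨s * t, fun h => (hQ.mem_or_mem h).elim hs ht, t • x + s • y,
          K.add_mem (K.smul_mem _ hx) (K.smul_mem _ hy), ?_⟩
        rw [map_add, map_smul, map_smul, e, e', smul_add, smul_smul, smul_smul, mul_comm t s]
      smul_mem' := by
        rintro c z ⟨s, hs, x, hx, e⟩
        exact ⟨s, hs, c • x, K.smul_mem _ hx, by rw [map_smul, e, smul_comm]⟩ }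
  have adm₁ : ∀ K, Adm Q K → Adm Q (K.comap i) := by
    rintro K ⟨h1, h2⟩
    refine ⟨fun s hs x hx => h1 s hs (i x) (by simpa using hx), fun x hx => ?_⟩
    obtain ⟨k, hk⟩ := h2 (i x) hx
    refine ⟨k, fun a ha => ?_⟩
    obtain ⟨s, hs, e⟩ := hk a ha
    exact ⟨s, hs, hi (by simpa using e)⟩
  have adm₃ : ∀ K, Adm Q K → Adm Q (sat K) := by
    rintro K ⟨h1, h2⟩
    constructor
    · rintro s hs z ⟨t, ht, x, hx, e⟩
      exact ⟨t * s, fun h => (hQ.mem_or_mem h).elim ht hs, x, hx, by rw [e, mul_smul]⟩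
    · rintro z ⟨t, ht, x, hx, e⟩
      obtain ⟨k, hk⟩ := h2 x hx
      refine ⟨k, fun a ha => ?_⟩
      obtain ⟨s, hs, e'⟩ := hk a ha
      refine ⟨s * t, fun h => (hQ.mem_or_mem h).elim hs ht, ?_⟩
      rw [mul_smul, smul_comm t a z, ← e, ← map_smul, ← map_smul, e', map_zero]
  have mono₁ : ∀ K L, Adm Q K → Adm Q L → K ≤ L → f₁ (K.comap i) ≤ f₁ (L.comap i) := by
    intro K L hK hL h
    rcases (Submodule.comap_mono (f := i) h).eq_or_lt with e | e
    · rw [e]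
    · exact (lt₁ _ _ (adm₁ K hK) (adm₁ L hL) e).le
  have satmono : ∀ K L, K ≤ L → sat K ≤ sat L := by
    rintro K L h z ⟨s, hs, x, hx, e⟩
    exact ⟨s, hs, x, h hx, e⟩
  refine ⟨fun K => f₁ (K.comap i) + f₃ (sat K),
    fun K hK => add_le_add (le₁ _ (adm₁ K hK)) (le₃ _ (adm₃ K hK)), fun K L hK hL hlt => ?_⟩
  rcases (Submodule.comap_mono (f := i) hlt.le).eq_or_lt with e | e
  · rcases (satmono _ _ hlt.le).eq_or_lt with e' | e'
    · exfalso
      refine hlt.not_ge fun x hx => ?_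
      have hz : g x ∈ sat L := ⟨1, fun h => hQ.ne_top ((Ideal.eq_top_iff_one _).2 h), x, hx,
        by simp⟩
      rw [← e'] at hz
      obtain ⟨s, hs, y, hy, ey⟩ := hz
      obtain ⟨w, hw⟩ := hig (s • x - y) (by rw [map_sub, map_smul, ey, sub_self])
      have hw1 : w ∈ L.comap i := by
        rw [Submodule.mem_comap, hw]
        exact L.sub_mem (L.smul_mem _ hx) (hlt.le hy)
      rw [← e, Submodule.mem_comap, hw] at hw1
      exact hK.1 s hs x (by simpa using K.add_mem hw1 hy)
    · exact add_lt_add_of_le_of_lt (mono₁ K L hK hL hlt.le) (lt₃ _ _ (adm₃ K hK) (adm₃ L hL) e')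
  · refine add_lt_add_of_lt_of_le (lt₁ _ _ (adm₁ K hK) (adm₁ L hL) e) ?_
    rcases (satmono _ _ hlt.le).eq_or_lt with e' | e'
    · simp only [e', le_refl]
    · exact (lt₃ _ _ (adm₃ K hK) (adm₃ L hL) e').le

theorem Bd.quot (hQ : Q.IsPrime) (P : Ideal R) (hP : P.IsPrime) : Bd Q (R ⧸ P) 1 := by
  classical
  by_cases h1 : Q ≤ P
  · by_cases h2 : P ≤ Q
    · have hPQ : P = Q := le_antisymm h2 h1
      subst hPQ
      refine ⟨fun K => if K = ⊥ then 0 else 1, fun K _ => by dsimp only; split_ifs <;> simp,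
        fun K L hK hL hlt => ?_⟩
      have hL0 : L ≠ ⊥ := (bot_le.trans_lt hlt).ne'
      have hK0 : K = ⊥ := by
        by_contra hne
        obtain ⟨x, hx, hx0⟩ := Submodule.exists_mem_ne_zero_of_ne_bot hne
        obtain ⟨s, rfl⟩ := Ideal.Quotient.mk_surjective x
        have hs : s ∉ P := fun h => hx0 (Ideal.Quotient.eq_zero_iff_mem.2 h)
        refine hlt.not_ge fun y _ => hK.1 s hs y ?_
        obtain ⟨t, rfl⟩ := Ideal.Quotient.mk_surjective y
        have : s • Ideal.Quotient.mk P t = t • Ideal.Quotient.mk P s := by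
          rw [← Ideal.Quotient.mk_eq_mk, ← Ideal.Quotient.mk_eq_mk, ← Submodule.Quotient.mk_smul,
            ← Submodule.Quotient.mk_smul, smul_eq_mul, smul_eq_mul, mul_comm]
        rw [this]
        exact K.smul_mem _ hx
      simp [hK0, hL0]
    · obtain ⟨s, hs, hsQ⟩ := SetLike.not_le_iff_exists.1 h2
      refine (Bd.of_kill hsQ fun x => ?_).mono (Nat.zero_le _)
      obtain ⟨t, rfl⟩ := Ideal.Quotient.mk_surjective x
      rw [Algebra.smul_def, Ideal.Quotient.algebraMap_eq, Ideal.Quotient.eq_zero_iff_mem.2 hs,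
        zero_mul]
  · obtain ⟨s, hs, hsQ⟩ := SetLike.not_le_iff_exists.1 h1
    refine (Bd.of_regular hs fun x hx => ?_).mono (Nat.zero_le _)
    rw [Algebra.smul_def, Ideal.Quotient.algebraMap_eq] at hx
    exact (mul_eq_zero.1 hx).resolve_left fun h => hsQ (Ideal.Quotient.eq_zero_iff_mem.1 h)

end bdlemmas

/-- A fixed finitely generated module over a Noetherian ring. -/
theorem exists_bd_fixed {R : Type} [CommRing R] [IsNoetherianRing R] (N : Type) [AddCommGroup N]
    [Module R N] [hN : Module.Finite R N] : ∃ B : ℕ, ∀ Q : Ideal R, Q.IsPrime → Bd Q N B := by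
  induction hN using IsNoetherianRing.induction_on_isQuotientEquivQuotientPrime R with
  | subsingleton N => exact ⟨0, fun Q _ => Bd.of_subsingleton⟩
  | quotient N p f =>
    refine ⟨1 + 0, fun Q hQ => ?_⟩
    exact Bd.exact hQ f.symm.toLinearMap (0 : N →ₗ[R] PUnit) f.symm.injective
      (fun x _ => ⟨f x, by simp⟩) (Bd.quot hQ p.1 p.2) Bd.of_subsingleton
  | exact N₁ N₂ N₃ f g hf _ hfg h₁ h₃ =>
    obtain ⟨b₁, h₁⟩ := h₁
    obtain ⟨b₃, h₃⟩ := h₃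
    exact ⟨b₁ + b₃, fun Q hQ => Bd.exact hQ f g hf (fun x hx => (hfg x).1 hx) (h₁ Q hQ) (h₃ Q hQ)⟩

/-- The rank bound. -/
theorem Bd.of_rank {R : Type*} [CommRing R] {Q : Ideal R} {N : Type*} [AddCommGroup N] [Module R N]
    {k : Type*} [CommRing k] [IsDomain k] [Module k N] (lift : k → R)
    (hlift : ∀ c (x : N), c • x = lift c • x) (hQ : ∀ c, c ≠ 0 → lift c ∉ Q)
    (T : Finset N) (hT : ∀ x : N, ∃ c : k, c ≠ 0 ∧ c • x ∈ Submodule.span k (T : Set N)) :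
    Bd Q N T.card := by
  let r : Submodule R N → Submodule k N := fun K =>
    { carrier := K
      zero_mem' := K.zero_mem
      add_mem' := K.add_mem
      smul_mem' := fun c x hx => by rw [hlift]; exact K.smul_mem _ hx }
  have hrank : Module.rank k N ≤ T.card := by
    rw [← Submodule.rank_quotient_add_rank (Submodule.span k (T : Set N))]
    have h0 : Module.rank k (N ⧸ Submodule.span k (T : Set N)) = 0 := by
      rw [rank_eq_zero_iff]
      intro x
      obtain ⟨x, rfl⟩ := Submodule.Quotient.mk_surjective _ x
      obtain ⟨c, hc, h⟩ := hT x
      exact ⟨c, hc, by rwa [← Submodule.Quotient.mk_smul, Submodule.Quotient.mk_eq_zero]⟩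
    rw [h0, zero_add]
    exact rank_span_finset_le T
  have hsub : ∀ K : Submodule k N, Module.rank k K ≤ T.card := fun K =>
    (Submodule.rank_le K).trans hrank
  refine ⟨fun K => Module.finrank k (r K), fun K _ => Module.finrank_le_of_rank_le (hsub _),
    fun K L hK hL hlt => ?_⟩
  have hle : r K ≤ r L := hlt.le
  have h1 := Submodule.rank_quotient_add_rank ((r K).submoduleOf (r L))
  rw [(Submodule.submoduleOfEquivOfLe hle).rank_eq] at h1
  have h2 : Module.rank k (↥(r L) ⧸ (r K).submoduleOf (r L)) ≠ 0 := by
    intro h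
    rw [rank_eq_zero_iff] at h
    obtain ⟨x, hxL, hxK⟩ := SetLike.exists_of_lt hlt
    obtain ⟨c, hc, e⟩ := h (Submodule.Quotient.mk ⟨x, hxL⟩)
    rw [← Submodule.Quotient.mk_smul, Submodule.Quotient.mk_eq_zero] at e
    have e' : c • x ∈ K := e
    rw [hlift] at e'
    exact hxK (hK.1 _ (hQ c hc) x e')
  have hfin : Module.rank k (r L) < Cardinal.aleph0 :=
    (hsub _).trans_lt (Cardinal.natCast_lt_aleph0)
  have hfinK : Module.rank k (r K) < Cardinal.aleph0 :=
    (hsub _).trans_lt (Cardinal.natCast_lt_aleph0)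
  have h3 : Module.rank k (r K) < Module.rank k (r L) := by
    rw [← h1] at hfin ⊢
    obtain ⟨a, ha⟩ := Cardinal.lt_aleph0.1 hfinK
    obtain ⟨b, hb⟩ := Cardinal.lt_aleph0.1 ((self_le_add_right _ _).trans_lt hfin)
    rw [hb] at h2
    rw [ha, hb]
    norm_cast at h2 ⊢
    omega
  exact Cardinal.toNat_lt_toNat h3 hfin

/-- Away from finitely many primes, a finitely generated module has no `p`-torsion. -/
theorem exists_no_torsion {R : Type} [CommRing R] [IsNoetherianRing R] (M : Type) [AddCommGroup M]
    [Module R M] [Module.Finite R M] :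
    ∃ c : ℕ, c ≠ 0 ∧ ∀ p : ℕ, p.Prime → ¬ p ∣ c → ∀ x : M, (p : R) • x = 0 → x = 0 := by
  let K : ℕ →o Submodule R M :=
    { toFun := fun m => LinearMap.ker (LinearMap.lsmul R M (m.factorial : R))
      monotone' := by
        intro a b hab x hx
        rw [LinearMap.mem_ker, LinearMap.lsmul_apply] at hx ⊢
        obtain ⟨d, hd⟩ := Nat.factorial_dvd_factorial hab
        rw [hd, mul_comm, Nat.cast_mul, mul_smul, hx, smul_zero] }
  obtain ⟨m, hm⟩ := monotone_stabilizes_iff_noetherian.mpr (inferInstance : IsNoetherian R M) K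
  refine ⟨m.factorial, m.factorial_ne_zero, fun p hp hpm x hx => ?_⟩
  have hmp : m < p := by
    by_contra h
    exact hpm ((Nat.Prime.dvd_factorial hp).2 (not_lt.1 h))
  have h1 : x ∈ K p := by
    change (p.factorial : R) • x = 0
    obtain ⟨d, hd⟩ := Nat.dvd_factorial hp.pos le_rfl
    rw [hd, mul_comm, Nat.cast_mul, mul_smul, hx, smul_zero]
  rw [← hm p hmp.le] at h1
  have h2 : (m.factorial : R) • x = 0 := h1
  have hco : IsCoprime (p : ℤ) (m.factorial : ℤ) :=
    Nat.isCoprime_iff_coprime.2 ((Nat.Prime.coprime_iff_not_dvd hp).2 hpm)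
  obtain ⟨u, v, huv⟩ := hco
  have h3 : (u : R) * (p : R) + (v : R) * (m.factorial : R) = 1 := by exact_mod_cast congrArg (Int.cast : ℤ → R) huv
  rw [← one_smul R x, ← h3, add_smul, mul_smul, mul_smul, hx, h2, smul_zero, smul_zero, add_zero]

theorem mem_pSM {n p : ℕ} {N : Type*} [AddCommGroup N] [Module (Rint n) N] {x : N} :
    x ∈ pSM n p N ↔ ∃ y, (p : Rint n) • y = x := by
  rw [pSM, Submodule.ideal_span_singleton_smul, Submodule.mem_smul_pointwise_iff_exists]
  simp

/-- The bound for almost all primes. -/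
def EvBd (n : ℕ) (M : Type) [AddCommGroup M] [Module (Rint n) M] : Prop :=
  ∃ c : ℕ, c ≠ 0 ∧ ∃ B : ℕ, ∀ p : ℕ, p.Prime → ¬ p ∣ c →
    ∀ Q : Ideal (Rint n), Q.IsPrime → Bd Q (Mbar n p M) B

theorem EvBd.exact {n : ℕ} {M₁ M₂ M₃ : Type} [AddCommGroup M₁] [Module (Rint n) M₁]
    [AddCommGroup M₂] [Module (Rint n) M₂] [AddCommGroup M₃] [Module (Rint n) M₃]
    [Module.Finite (Rint n) M₃] (f : M₁ →ₗ[Rint n] M₂) (g : M₂ →ₗ[Rint n] M₃)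
    (hf : Function.Injective f) (hg : Function.Surjective g) (hfg : Function.Exact f g)
    (h₁ : EvBd n M₁) (h₃ : EvBd n M₃) : EvBd n M₂ := by
  obtain ⟨c₁, hc₁, b₁, h₁⟩ := h₁
  obtain ⟨c₃, hc₃, b₃, h₃⟩ := h₃
  obtain ⟨c, hc, hT⟩ := exists_no_torsion (R := Rint n) M₃
  refine ⟨c₁ * c₃ * c, by positivity, b₁ + b₃, fun p hp hpc Q hQ => ?_⟩
  have e₁ : ¬ p ∣ c₁ := fun h => hpc ((h.mul_right c₃).mul_right c)
  have e₃ : ¬ p ∣ c₃ := fun h => hpc ((h.mul_left c₁).mul_right c)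
  have e : ¬ p ∣ c := fun h => hpc (h.mul_left _)
  have k₁ : pSM n p M₁ ≤ (pSM n p M₂).comap f := by
    intro x hx
    obtain ⟨y, rfl⟩ := mem_pSM.1 hx
    exact mem_pSM.2 ⟨f y, by simp⟩
  have k₃ : pSM n p M₂ ≤ (pSM n p M₃).comap g := by
    intro x hx
    obtain ⟨y, rfl⟩ := mem_pSM.1 hx
    exact mem_pSM.2 ⟨g y, by simp⟩
  refine Bd.exact hQ (Submodule.mapQ _ _ f k₁) (Submodule.mapQ _ _ g k₃) ?_ ?_
    (h₁ p hp e₁ Q hQ) (h₃ p hp e₃ Q hQ)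
  · rw [injective_iff_map_eq_zero]
    intro x hx
    obtain ⟨x, rfl⟩ := Submodule.Quotient.mk_surjective _ x
    rw [Submodule.mapQ_apply, Submodule.Quotient.mk_eq_zero] at hx
    obtain ⟨y, hy⟩ := mem_pSM.1 hx
    have : g y = 0 := hT p hp e _ (by rw [← map_smul, hy]; exact (hfg _).2 ⟨x, rfl⟩)
    obtain ⟨z, rfl⟩ := (hfg y).1 this
    rw [Submodule.Quotient.mk_eq_zero]
    exact mem_pSM.2 ⟨z, hf (by rw [map_smul, hy])⟩
  · intro x hx
    obtain ⟨x, rfl⟩ := Submodule.Quotient.mk_surjective _ x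
    rw [Submodule.mapQ_apply, Submodule.Quotient.mk_eq_zero] at hx
    obtain ⟨y, hy⟩ := mem_pSM.1 hx
    obtain ⟨z, rfl⟩ := hg y
    obtain ⟨w, hw⟩ := (hfg (x - (p : Rint n) • z)).1 (by rw [map_sub, map_smul, hy, sub_self])
    refine ⟨Submodule.Quotient.mk w, ?_⟩
    rw [Submodule.mapQ_apply, hw, Submodule.Quotient.eq]
    exact mem_pSM.2 ⟨-z, by simp⟩

/-- Away from finitely many primes, multiplication by an injective scalar stays injective mod `p`. -/
theorem exists_regular_mod {R : Type} [CommRing R] [IsNoetherianRing R] (M : Type) [AddCommGroup M]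
    [Module R M] [Module.Finite R M] (g : R) (hg : ∀ x : M, g • x = 0 → x = 0) :
    ∃ c : ℕ, c ≠ 0 ∧ ∀ p : ℕ, p.Prime → ¬ p ∣ c →
      ∀ x y : M, (p : R) • y = g • x → ∃ z, (p : R) • z = x := by
  obtain ⟨c, hc, h⟩ := exists_no_torsion (R := R) (M ⧸ LinearMap.range (LinearMap.lsmul R M g))
  refine ⟨c, hc, fun p hp hpc x y hxy => ?_⟩
  have := h p hp hpc (Submodule.Quotient.mk y) (by
    rw [← Submodule.Quotient.mk_smul, Submodule.Quotient.mk_eq_zero, hxy]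
    exact ⟨x, rfl⟩)
  rw [Submodule.Quotient.mk_eq_zero] at this
  obtain ⟨z, rfl⟩ := this
  refine ⟨z, ?_⟩
  rw [← sub_eq_zero]
  apply hg
  rw [smul_sub, ← hxy, sub_eq_zero, smul_comm]
  rfl

/-- Generic finiteness of an algebraic finite type extension of domains. -/
theorem exists_generic {A D : Type} [CommRing A] [IsDomain A] [CommRing D] [IsDomain D]
    [Algebra A D] [Algebra.FiniteType A D] [Algebra.IsAlgebraic A D] :
    ∃ g : A, g ≠ 0 ∧ (∃ T : Finset D, ∀ d : D, ∃ k : ℕ, g ^ k • d ∈ Submodule.span A (T : Set D)) ∧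
      ∃ b : Set D, LinearIndepOn A id b ∧ ∀ d : D, ∃ k : ℕ, g ^ k • d ∈ Submodule.span A b := by
  classical
  obtain ⟨X, hX⟩ := (Algebra.FiniteType.out : (⊤ : Subalgebra A D).FG)
  obtain ⟨y, hy, hintg⟩ := Algebra.IsAlgebraic.exists_integral_multiples A X
  set E := Algebra.adjoin A ((fun z => y • z) '' (X : Set D)) with hE
  have hfg : E.toSubmodule.FG := by
    apply fg_adjoin_of_finite (X.finite_toSet.image _)
    rintro _ ⟨z, hz, rfl⟩
    exact hintg z hz
  obtain ⟨T, hT⟩ := hfg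
  have hEk : ∀ d : D, ∃ k : ℕ, ∀ j, k ≤ j → y ^ j • d ∈ E := by
    intro d
    have hd : d ∈ Algebra.adjoin A (X : Set D) := by rw [hX]; trivial
    induction hd using Algebra.adjoin_induction with
    | mem x hx =>
      refine ⟨1, fun j hj => ?_⟩
      obtain ⟨i, rfl⟩ := Nat.exists_eq_add_of_le' hj
      rw [pow_succ, mul_smul]
      exact E.smul_mem (Algebra.subset_adjoin ⟨x, hx, rfl⟩) _
    | algebraMap r => exact ⟨0, fun j _ => E.smul_mem (E.algebraMap_mem r) _⟩
    | add u v _ _ hu hv =>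
      obtain ⟨k, hk⟩ := hu
      obtain ⟨l, hl⟩ := hv
      refine ⟨k + l, fun j hj => ?_⟩
      rw [smul_add]
      exact E.add_mem (hk j (by omega)) (hl j (by omega))
    | mul u v _ _ hu hv =>
      obtain ⟨k, hk⟩ := hu
      obtain ⟨l, hl⟩ := hv
      refine ⟨k + l, fun j hj => ?_⟩
      obtain ⟨i, rfl⟩ := Nat.exists_eq_add_of_le hj
      have : y ^ (k + l + i) • (u * v) = (y ^ k • u) * (y ^ (l + i) • v) := by
        rw [smul_mul_smul_comm, ← pow_add, add_assoc]
      rw [this]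
      exact E.mul_mem (hk k le_rfl) (hl _ (by omega))
  obtain ⟨b, hb, hmax⟩ := exists_maximal_linearIndepOn A (id : D → D)
  rw [Set.image_id] at hmax
  have hmax' : ∀ d : D, ∃ a : A, a ≠ 0 ∧ a • d ∈ Submodule.span A b := by
    intro d
    by_cases h : d ∈ b
    · exact ⟨1, one_ne_zero, by rw [one_smul]; exact Submodule.subset_span h⟩
    · exact hmax d h
  choose a ha ha' using hmax'
  set c := ∏ t ∈ T, a t with hc
  have hc0 : c ≠ 0 := Finset.prod_ne_zero_iff.2 fun t _ => ha t
  have hcE : ∀ e ∈ E, c • e ∈ Submodule.span A b := by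
    intro e he
    have he' : e ∈ Submodule.span A (T : Set D) := by rw [hT]; exact he
    have hle : Submodule.span A (T : Set D) ≤
        (Submodule.span A b).comap (LinearMap.lsmul A D c) := by
      rw [Submodule.span_le]
      intro t ht
      change c • t ∈ Submodule.span A b
      rw [hc, ← Finset.prod_erase_mul _ _ ht, mul_smul]
      exact Submodule.smul_mem _ _ (ha' t)
    exact hle he'
  refine ⟨y * c, mul_ne_zero hy hc0, ⟨T, fun d => ?_⟩, b, hb, fun d => ?_⟩
  · obtain ⟨k, hk⟩ := hEk d
    refine ⟨k, ?_⟩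
    rw [hT, mul_pow, mul_comm, mul_smul]
    exact E.smul_mem (hk k le_rfl) _
  · obtain ⟨k, hk⟩ := hEk d
    refine ⟨k + 1, ?_⟩
    have : (y * c) ^ (k + 1) • d = c ^ k • c • y ^ (k + 1) • d := by
      rw [smul_smul, smul_smul]; congr 1; ring
    rw [this]
    exact Submodule.smul_mem _ _ (hcE _ (hk _ (by omega)))

/-- Elements of `A` outside `(π)` act injectively on `D / π D`. -/
theorem regular_of_generic {A D : Type*} [CommRing A] [IsDomain A] [AddCommGroup D] [Module A D]
    {π g : A} (hπ : Prime π) (b : Set D) (hb : LinearIndepOn A id b)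
    (hg : ∀ d : D, ∃ k : ℕ, g ^ k • d ∈ Submodule.span A b)
    (hreg : ∀ x y : D, π • y = g • x → ∃ z, π • z = x)
    {a : A} (ha : ¬ π ∣ a) (x y : D) (hxy : π • y = a • x) : ∃ z, π • z = x := by
  have hregk : ∀ (k : ℕ) (x y : D), π • y = g ^ k • x → ∃ z, π • z = x := by
    intro k
    induction k with
    | zero => intro x y h; exact ⟨y, by simpa using h⟩
    | succ k ih =>
      intro x y h
      rw [pow_succ, mul_smul] at h
      obtain ⟨z, hz⟩ := ih _ _ h
      exact hreg _ _ hz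
  obtain ⟨k, hk⟩ := hg x
  obtain ⟨l, hl⟩ := hg y
  have hx' : g ^ (k + l) • x ∈ Submodule.span A b := by
    rw [pow_add, mul_comm, mul_smul]; exact Submodule.smul_mem _ _ hk
  have hy' : g ^ (k + l) • y ∈ Submodule.span A b := by
    rw [pow_add, mul_smul]; exact Submodule.smul_mem _ _ hl
  have hb' : LinearIndependent A ((↑) : b → D) := hb
  rw [← Subtype.range_coe (s := b)] at hx' hy'
  obtain ⟨u, hu⟩ := Finsupp.mem_span_range_iff_exists_finsupp.1 hx'
  obtain ⟨v, hv⟩ := Finsupp.mem_span_range_iff_exists_finsupp.1 hy'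
  have huv : π • v = a • u := by
    apply hb'
    rw [map_smul, map_smul, Finsupp.linearCombination_apply, Finsupp.linearCombination_apply,
      hu, hv, smul_comm, hxy, smul_comm]
  have hdiv : ∀ i, ∃ w, u i = π * w := fun i => by
    have h := DFunLike.congr_fun huv i
    simp only [Finsupp.smul_apply, smul_eq_mul] at h
    exact (hπ.dvd_or_dvd ⟨v i, h.symm⟩).resolve_left ha
  choose w hw using hdiv
  apply hregk (k + l) x (u.sum fun i _ => w i • (i : D))
  rw [← hu, Finsupp.sum, Finsupp.sum, Finset.smul_sum]
  refine Finset.sum_congr rfl fun i _ => ?_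
  rw [hw i, mul_smul]

/-- The torsion-free case, with a polynomial subring. -/
theorem EvBd.of_algebraic {n : ℕ} (P : Ideal (Rint n)) (hP : P.IsPrime) {A : Type} [CommRing A]
    [IsDomain A] [Algebra A (Rint n)] (hprime : ∀ p : ℕ, p.Prime → Prime (p : A))
    (hinj : Function.Injective (algebraMap A (Rint n ⧸ P)))
    [Algebra.IsAlgebraic A (Rint n ⧸ P)] [Algebra.FiniteType A (Rint n ⧸ P)] :
    EvBd n (Rint n ⧸ P) := by
  classical
  obtain ⟨g, hg0, ⟨T, hT⟩, b, hb, hgb⟩ := exists_generic (A := A) (D := Rint n ⧸ P)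
  have hsm : ∀ (a : A) (x : Rint n ⧸ P), algebraMap A (Rint n) a • x = a • x := fun a x =>
    algebraMap_smul (Rint n) a x
  obtain ⟨c, hc, hreg⟩ := exists_regular_mod (Rint n ⧸ P) (algebraMap A (Rint n) g) (by
    intro x hx
    rw [hsm] at hx
    refine (mul_eq_zero.1 ((Algebra.smul_def g x).symm.trans hx)).resolve_left fun h => hg0 (hinj (by rw [h, map_zero])))
  refine ⟨c, hc, T.card, fun p hp hpc Q hQ => ?_⟩
  have hpA : ∀ x : Rint n ⧸ P, (p : Rint n) • x = (p : A) • x := fun x => by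
    rw [← hsm, map_natCast]
  have hregA : ∀ x y : Rint n ⧸ P, (p : A) • y = g • x → ∃ z, (p : A) • z = x := by
    intro x y h
    obtain ⟨z, hz⟩ := hreg p hp hpc x y (by rw [hsm, hpA, h])
    exact ⟨z, by rw [← hpA, hz]⟩
  by_cases hgp : (p : A) ∣ g
  · obtain ⟨h, hh⟩ := hgp
    have : Subsingleton (Mbar n p (Rint n ⧸ P)) := by
      rw [Submodule.Quotient.subsingleton_iff, eq_top_iff]
      intro x _
      obtain ⟨z, hz⟩ := hregA x (h • x) (by rw [hh, mul_smul])
      exact mem_pSM.2 ⟨z, by rw [hpA, hz]⟩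
    exact Bd.of_subsingleton.mono (Nat.zero_le _)
  by_cases hex : ∃ a : A, ¬ (p : A) ∣ a ∧ algebraMap A (Rint n) a ∈ Q
  · obtain ⟨a, ha, haQ⟩ := hex
    refine (Bd.of_regular haQ fun x hx => ?_).mono (Nat.zero_le _)
    obtain ⟨x, rfl⟩ := Submodule.Quotient.mk_surjective _ x
    rw [← Submodule.Quotient.mk_smul, Submodule.Quotient.mk_eq_zero] at hx
    obtain ⟨y, hy⟩ := mem_pSM.1 hx
    obtain ⟨z, hz⟩ := regular_of_generic (hprime p hp) b hb hgb hregA ha x y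
      (by rw [← hpA, hy, hsm])
    rw [Submodule.Quotient.mk_eq_zero]
    exact mem_pSM.2 ⟨z, by rw [hpA, hz]⟩
  · push Not at hex
    let I : Ideal A := Ideal.span {(p : A)}
    have hI : I.IsPrime := (Ideal.span_singleton_prime (hprime p hp).ne_zero).2 (hprime p hp)
    have htors : Module.IsTorsionBySet A (Mbar n p (Rint n ⧸ P)) (I : Set A) := by
      rw [Module.isTorsionBySet_span_singleton_iff]
      intro x
      obtain ⟨x, rfl⟩ := Submodule.Quotient.mk_surjective _ x
      rw [← Submodule.Quotient.mk_smul, Submodule.Quotient.mk_eq_zero]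
      exact mem_pSM.2 ⟨x, by rw [hpA]⟩
    let _ : Module (A ⧸ I) (Mbar n p (Rint n ⧸ P)) := htors.module
    have hmk : ∀ (a : A) (x : Mbar n p (Rint n ⧸ P)), Ideal.Quotient.mk I a • x = a • x :=
      fun a x => Module.IsTorsionBySet.mk_smul htors a x
    have hsm' : ∀ (a : A) (x : Mbar n p (Rint n ⧸ P)), algebraMap A (Rint n) a • x = a • x :=
      fun a x => algebraMap_smul (Rint n) a x
    have hmkz : ∀ a : A, Ideal.Quotient.mk I a = 0 ↔ (p : A) ∣ a := fun a => by
      rw [Ideal.Quotient.eq_zero_iff_mem, Ideal.mem_span_singleton]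
    let s : A ⧸ I → A := Function.surjInv Ideal.Quotient.mk_surjective
    have hs : ∀ c, Ideal.Quotient.mk I (s c) = c := Function.surjInv_eq _
    refine (Bd.of_rank (k := A ⧸ I) (fun c => algebraMap A (Rint n) (s c))
      (fun c x => ?_) (fun c hc0 => ?_) (T.image Submodule.Quotient.mk) ?_).mono
      Finset.card_image_le
    · rw [hsm', ← hmk, hs]
    · exact hex _ fun h => hc0 (by rw [← hs c, hmkz]; exact h)
    · intro x
      obtain ⟨x, rfl⟩ := Submodule.Quotient.mk_surjective _ x
      obtain ⟨k, hk⟩ := hT x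
      refine ⟨Ideal.Quotient.mk I (g ^ k), ?_, ?_⟩
      · rw [Ne, hmkz]
        exact fun h => hgp ((hprime p hp).dvd_of_dvd_pow h)
      · rw [hmk, ← Submodule.Quotient.mk_smul]
        generalize g ^ k • x = d at hk ⊢
        induction hk using Submodule.span_induction with
        | mem t ht =>
          exact Submodule.subset_span (Finset.mem_coe.2 (Finset.mem_image_of_mem _ ht))
        | zero => rw [Submodule.Quotient.mk_zero]; exact Submodule.zero_mem _
        | add u v _ _ hu hv => rw [Submodule.Quotient.mk_add]; exact Submodule.add_mem _ hu hv
        | smul a u _ hu =>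
          rw [Submodule.Quotient.mk_smul, ← hmk]
          exact Submodule.smul_mem _ _ hu

theorem EvBd.quot {n : ℕ} (P : Ideal (Rint n)) (hP : P.IsPrime) : EvBd n (Rint n ⧸ P) := by
  by_cases hchar : ∃ c : ℕ, c ≠ 0 ∧ (c : Rint n) ∈ P
  · obtain ⟨c, hc, hcP⟩ := hchar
    refine ⟨c, hc, 0, fun p hp hpc Q hQ => ?_⟩
    have : Subsingleton (Mbar n p (Rint n ⧸ P)) := by
      rw [Submodule.Quotient.subsingleton_iff, eq_top_iff]
      intro x _
      have hco : IsCoprime (p : ℤ) (c : ℤ) :=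
        Nat.isCoprime_iff_coprime.2 ((Nat.Prime.coprime_iff_not_dvd hp).2 hpc)
      obtain ⟨u, v, huv⟩ := hco
      have h3 : (p : Rint n) * (u : Rint n) + (v : Rint n) * (c : Rint n) = 1 := by
        rw [mul_comm (p : Rint n)]
        exact_mod_cast congrArg (Int.cast : ℤ → Rint n) huv
      have hcx : (c : Rint n) • x = 0 := by
        obtain ⟨t, rfl⟩ := Ideal.Quotient.mk_surjective x
        rw [← Ideal.Quotient.mk_eq_mk, ← Submodule.Quotient.mk_smul, Submodule.Quotient.mk_eq_zero,
          smul_eq_mul]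
        exact P.mul_mem_right _ hcP
      refine mem_pSM.2 ⟨(u : Rint n) • x, ?_⟩
      conv_rhs => rw [← one_smul (Rint n) x, ← h3, add_smul, mul_smul, mul_smul, hcx, smul_zero,
        add_zero]
    exact Bd.of_subsingleton
  · push Not at hchar
    have hinjZ : Function.Injective (algebraMap ℤ (Rint n ⧸ P)) := by
      rw [injective_iff_map_eq_zero]
      intro z hz
      by_contra hz0
      apply hchar z.natAbs (by simpa using hz0)
      have h1 : (z : Rint n) ∈ P := by
        rw [← Ideal.Quotient.eq_zero_iff_mem, map_intCast]
        simpa using hz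
      rcases Int.natAbs_eq z with h | h
      · rw [h] at h1
        simpa using h1
      · rw [h] at h1
        simpa using h1
    have : FaithfulSMul ℤ (Rint n ⧸ P) := (faithfulSMul_iff_algebraMap_injective _ _).2 hinjZ
    obtain ⟨s, hs⟩ := exists_isTranscendenceBasis ℤ (Rint n ⧸ P)
    let l : s → Rint n := fun i => Function.surjInv Ideal.Quotient.mk_surjective (i : Rint n ⧸ P)
    have hl : ∀ i, Ideal.Quotient.mk P (l i) = i := fun i => Function.surjInv_eq _ _
    let _ : Algebra (MvPolynomial s ℤ) (Rint n) := (MvPolynomial.aeval l).toRingHom.toAlgebra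
    have halg : ∀ f : MvPolynomial s ℤ, algebraMap (MvPolynomial s ℤ) (Rint n ⧸ P) f =
        MvPolynomial.aeval ((↑) : s → Rint n ⧸ P) f := by
      intro f
      have h1 : algebraMap (MvPolynomial s ℤ) (Rint n ⧸ P) f =
        (Ideal.Quotient.mkₐ ℤ P) (MvPolynomial.aeval l f) := rfl
      rw [h1, ← AlgHom.comp_apply, MvPolynomial.comp_aeval]
      congr 2
      funext i
      exact hl i
    have hinj : Function.Injective (algebraMap (MvPolynomial s ℤ) (Rint n ⧸ P)) := by
      intro f f' h
      rw [halg, halg] at h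
      exact hs.1 h
    have : IsScalarTower ℤ (MvPolynomial s ℤ) (Rint n ⧸ P) := inferInstance
    have : Algebra.IsAlgebraic (MvPolynomial s ℤ) (Rint n ⧸ P) := by
      rw [hs.isAlgebraic_iff]
      intro i
      have : (i : Rint n ⧸ P) = algebraMap (MvPolynomial s ℤ) (Rint n ⧸ P) (MvPolynomial.X i) := by
        rw [halg, MvPolynomial.aeval_X]
      rw [this]
      exact isAlgebraic_algebraMap _
    have : Algebra.FiniteType (MvPolynomial s ℤ) (Rint n ⧸ P) :=
      Algebra.FiniteType.of_restrictScalars_finiteType ℤ _ _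
    refine EvBd.of_algebraic P hP (A := MvPolynomial s ℤ) (fun p hp => ?_) hinj
    have h := (MvPolynomial.prime_C_iff (σ := s) (r := (p : ℤ))).2 (Nat.prime_iff_prime_int.1 hp)
    simpa using h

theorem EvBd.all {n : ℕ} (M : Type) [AddCommGroup M] [Module (Rint n) M]
    [hM : Module.Finite (Rint n) M] : EvBd n M := by
  have hsub : ∀ (N : Type) [AddCommGroup N] [Module (Rint n) N] [Subsingleton N], EvBd n N := by
    intro N _ _ _
    refine ⟨1, one_ne_zero, 0, fun p _ _ Q _ => ?_⟩
    have : Subsingleton (Mbar n p N) :=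
      (Submodule.Quotient.mk_surjective (pSM n p N)).subsingleton
    exact Bd.of_subsingleton
  induction hM using IsNoetherianRing.induction_on_isQuotientEquivQuotientPrime (Rint n) with
  | subsingleton N => exact hsub N
  | quotient N p f =>
    exact EvBd.exact f.symm.toLinearMap (0 : N →ₗ[Rint n] PUnit) f.symm.injective
      (Function.surjective_to_subsingleton _)
      ((f.symm.exact_zero_iff_surjective _).2 f.symm.surjective) (EvBd.quot p.1 p.2) (hsub _)
  | exact N₁ N₂ N₃ f g hf hg hfg h₁ h₃ => exact EvBd.exact f g hf hg hfg h₁ h₃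

theorem exists_bd_all {n : ℕ} (M : Type) [AddCommGroup M] [Module (Rint n) M]
    [Module.Finite (Rint n) M] : ∃ B : ℕ, ∀ p : ℕ, p.Prime →
      ∀ Q : Ideal (Rint n), Q.IsPrime → Bd Q (Mbar n p M) B := by
  obtain ⟨c, hc, B, hB⟩ := EvBd.all (n := n) M
  have hfix : ∀ p : ℕ, ∃ b : ℕ, ∀ Q : Ideal (Rint n), Q.IsPrime → Bd Q (Mbar n p M) b :=
    fun p => exists_bd_fixed (Mbar n p M)
  choose b hb using hfix
  refine ⟨B + ∑ p ∈ c.divisors, b p, fun p hp Q hQ => ?_⟩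
  by_cases h : p ∣ c
  · refine (hb p Q hQ).mono (le_add_left ?_)
    exact Finset.single_le_sum (f := b) (fun _ _ => Nat.zero_le _) (Nat.mem_divisors.2 ⟨h, hc⟩)
  · exact (hB p hp h Q hQ).mono (Nat.le_add_right _ _)

/-- From the combinatorial bound to the length of the torsion of the localization. -/
theorem krullDim_le_of_bd {n p : ℕ} {N : Type} [AddCommGroup N] [Module (Rint n) N]
    [Module (RbarQ n p) N] [IsScalarTower (Rint n) (RbarQ n p) N] (q : Ideal (RbarQ n p))
    [hq : q.IsPrime] {B : ℕ}
    (h : Bd (q.comap (Ideal.Quotient.mk (Ideal.span {(p : Rint n)}))) N B) :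
    Order.krullDim (Submodule (Localization q.primeCompl)
      (Gamma (Ideal.map (algebraMap (RbarQ n p) (Localization q.primeCompl)) q)
        (N := LocalizedModule q.primeCompl N))) ≤ ((B : ℕ∞) : WithBot ℕ∞) := by
  set G := Gamma (Ideal.map (algebraMap (RbarQ n p) (Localization q.primeCompl)) q)
        (N := LocalizedModule q.primeCompl N) with hG
  set mk := Ideal.Quotient.mk (Ideal.span {(p : Rint n)}) with hmkdef
  have hsm : ∀ (r : Rint n) (x : N), mk r • x = r • x := fun r x => by
    rw [← one_smul (RbarQ n p) x, ← smul_assoc, ← smul_assoc]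
    congr 1
  let ι := LocalizedModule.mkLinearMap q.primeCompl N
  have hι : ∀ (r : RbarQ n p) (x : N), ι (r • x) =
      algebraMap (RbarQ n p) (Localization q.primeCompl) r • ι x := fun r x => by
    rw [map_smul, algebraMap_smul]
  have hunit : ∀ (s : RbarQ n p), s ∉ q → ∀ (U : Submodule (Localization q.primeCompl)
      (LocalizedModule q.primeCompl N)) (w : LocalizedModule q.primeCompl N),
      algebraMap (RbarQ n p) (Localization q.primeCompl) s • w ∈ U → w ∈ U := by
    intro s hs U w hw
    have hu : IsUnit (algebraMap (RbarQ n p) (Localization q.primeCompl) s) :=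
      IsLocalization.map_units (Localization q.primeCompl) (⟨s, hs⟩ : q.primeCompl)
    exact (Submodule.smul_mem_iff_of_isUnit U hu).1 hw
  let Φ : Submodule (Localization q.primeCompl) G → Submodule (Rint n) N := fun T =>
    { carrier := {x | ι x ∈ T.map G.subtype}
      zero_mem' := by
        change ι 0 ∈ T.map G.subtype
        rw [map_zero]
        exact Submodule.zero_mem _
      add_mem' := by
        intro x y hx hy
        change ι (x + y) ∈ T.map G.subtype
        rw [map_add]
        exact Submodule.add_mem _ hx hy
      smul_mem' := by
        intro r x hx
        change ι (r • x) ∈ T.map G.subtype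
        rw [← hsm, hι]
        exact Submodule.smul_mem _ _ hx }
  have hΦ : ∀ T x, x ∈ Φ T ↔ ι x ∈ T.map G.subtype := fun T x => Iff.rfl
  have hadm : ∀ T, Adm (q.comap mk) (Φ T) := by
    intro T
    constructor
    · intro s hs x hx
      rw [hΦ, ← hsm, hι] at hx
      exact hunit _ hs _ _ hx
    · intro x hx
      rw [hΦ] at hx
      obtain ⟨⟨w, k, hk⟩, -, hw⟩ := hx
      refine ⟨k, fun a ha => ?_⟩
      have ha' : mk a ∈ q ^ k := by
        have := Ideal.mem_map_of_mem mk ha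
        rw [Ideal.map_pow] at this
        exact Ideal.pow_right_mono Ideal.map_comap_le k this
      have h0 := hk (algebraMap _ _ (mk a)) (by
        rw [← Ideal.map_pow]; exact Ideal.mem_map_of_mem _ ha')
      change w = ι x at hw
      rw [hw, ← hι] at h0
      obtain ⟨s, hs⟩ := (IsLocalizedModule.eq_zero_iff q.primeCompl ι).1 h0
      obtain ⟨s, hsq⟩ := s
      obtain ⟨t, rfl⟩ := Ideal.Quotient.mk_surjective s
      refine ⟨t, hsq, ?_⟩
      rw [← hsm, ← hsm]
      exact hs
  have hmono : ∀ T U : Submodule (Localization q.primeCompl) G, T < U → Φ T < Φ U := by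
    intro T U hTU
    have hle : Φ T ≤ Φ U := fun x hx => Submodule.map_mono hTU.le hx
    refine lt_of_le_not_ge hle fun hge => hTU.not_ge ?_
    intro w hw
    obtain ⟨⟨x, s⟩, hxs⟩ := IsLocalizedModule.surj q.primeCompl ι (w : LocalizedModule q.primeCompl N)
    have hxs' : algebraMap (RbarQ n p) (Localization q.primeCompl) s • (w : LocalizedModule q.primeCompl N) = ι x := by
      rw [algebraMap_smul]; exact hxs
    have hx : x ∈ Φ U := by
      rw [hΦ, ← hxs']
      exact Submodule.smul_mem _ _ ⟨w, hw, rfl⟩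
    have hx' := hge hx
    rw [hΦ, ← hxs'] at hx'
    obtain ⟨w', hw', e⟩ := hunit s s.2 _ _ hx'
    have : w' = w := Subtype.ext e
    exact this ▸ hw'
  obtain ⟨f, hf1, hf2⟩ := h
  let F : Submodule (Localization q.primeCompl) G → Fin (B + 1) := fun T =>
    ⟨f (Φ T), Nat.lt_succ_of_le (hf1 _ (hadm T))⟩
  have hF : StrictMono F := fun T U hTU => hf2 _ _ (hadm T) (hadm U) (hmono T U hTU)
  refine iSup_le fun l => ?_
  have hl := (l.map F hF).length_lt_card
  rw [Fintype.card_fin] at hl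
  have hl' : l.length ≤ B := Nat.lt_succ_iff.1 hl
  exact_mod_cast hl'


/-- Let `M` be a finitely generated module over `R = ℤ[x₁,…,xₙ]`. Then the
supremum of `u(M/pM)` over all prime integers `p` is finite: there is `B : ℕ` such that for every
prime `p` and every associated prime `𝔮` of `M̄ = M/pM` (as an `R̄`-module, `R̄ = R/pR`), the
length of `Γ_{𝔮R̄_𝔮}(M̄_𝔮)` as an `R̄_𝔮`-module is at most `B`. -/
theorem stmt_7 (n : ℕ) (M : Type) [AddCommGroup M] [Module (Rint n) M]
    [Module.Finite (Rint n) M] :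
    ∃ B : ℕ, ∀ p : ℕ, p.Prime →
      ∀ q : Ideal (RbarQ n p), ∀ hq : q ∈ associatedPrimes (RbarQ n p) (Mbar n p M),
        letI : q.IsPrime := hq.1
        Order.krullDim (Submodule (Localization q.primeCompl)
          (Gamma (Ideal.map (algebraMap (RbarQ n p) (Localization q.primeCompl)) q)
            (N := LocalizedModule q.primeCompl (Mbar n p M)))) ≤ ((B : ℕ∞) : WithBot ℕ∞) := by
  obtain ⟨B, hB⟩ := exists_bd_all (n := n) M
  refine ⟨B, fun p hp q hq => ?_⟩
  have hqp : q.IsPrime := hq.1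
  exact krullDim_le_of_bd q (hB p hp _ (Ideal.IsPrime.comap _))
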